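/- arXiv:2206.07126 — 3 statements merged into one kernel-verified Lean document; each statement's English description precedes it below -/
import Mathlib

section
/- Let f : ℝ^d → ℝ be L-Lipschitz (d ≥ 1 an integer, L ≥ 0) and let δ > 0. Then the smoothed function f_δ is differentiable at every x ∈ ℝ^d and its gradient is given by ∇f_δ(x) = (d/δ)·E_u[f(x + δu) u], where u is uniformly distributed on the unit sphere 𝕊 of ℝ^d. -/
open MeasureTheory

/-- The uniform probability measure on the closed unit ball of `ℝ^d`. -/
noncomputable def ballUniform (d : ℕ) : Measure (EuclideanSpace ℝ (Fin d)) :=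
  (volume (Metric.closedBall (0 : EuclideanSpace ℝ (Fin d)) 1))⁻¹ •
    volume.restrict (Metric.closedBall (0 : EuclideanSpace ℝ (Fin d)) 1)

/-- The uniform (rotation-invariant) probability measure on the unit sphere of `ℝ^d`,
realized as the pushforward of the uniform measure on the unit ball under the radial
projection `v ↦ v / ‖v‖`. -/
noncomputable def sphereUniform (d : ℕ) : Measure (EuclideanSpace ℝ (Fin d)) :=
  Measure.map (fun v => ‖v‖⁻¹ • v) (ballUniform d)

/-- The smoothed version `f_δ(x) = E_{v ~ uniform ball} [f (x + δ v)]`. -/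
noncomputable def smoothed (d : ℕ) (f : EuclideanSpace ℝ (Fin d) → ℝ) (δ : ℝ)
    (x : EuclideanSpace ℝ (Fin d)) : ℝ :=
  ∫ v, f (x + δ • v) ∂(ballUniform d)

section UnitBall

variable {E : Type*} [NormedAddCommGroup E]

/-- The piecewise affine radial cutoff, equal to `1` on the ball of radius `1 - ε` and to `0`
outside the unit ball. -/
noncomputable def radialCutoff (ε : ℝ) (x : E) : ℝ := max 0 (min 1 (ε⁻¹ * (1 - ‖x‖)))

theorem radialCutoff_of_norm_le {ε : ℝ} (hε : 0 < ε) {x : E} (hx : ‖x‖ ≤ 1 - ε) :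
    radialCutoff ε x = 1 := by
  have : 1 ≤ ε⁻¹ * (1 - ‖x‖) := by
    rw [inv_mul_eq_div, one_le_div hε]; linarith
  simp [radialCutoff, this]

theorem radialCutoff_of_one_le_norm {ε : ℝ} (hε : 0 < ε) {x : E} (hx : 1 ≤ ‖x‖) :
    radialCutoff ε x = 0 := by
  have : ε⁻¹ * (1 - ‖x‖) ≤ 0 :=
    mul_nonpos_of_nonneg_of_nonpos (by positivity) (by linarith)
  simp [radialCutoff, this]

theorem radialCutoff_of_mem {ε : ℝ} (hε : 0 < ε) {x : E} (h1 : 1 - ε ≤ ‖x‖) (h2 : ‖x‖ ≤ 1) :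
    radialCutoff ε x = ε⁻¹ * (1 - ‖x‖) := by
  have h3 : ε⁻¹ * (1 - ‖x‖) ≤ 1 := by
    rw [inv_mul_eq_div, div_le_one hε]; linarith
  have h4 : 0 ≤ ε⁻¹ * (1 - ‖x‖) := mul_nonneg (by positivity) (by linarith)
  simp [radialCutoff, h3, h4]

theorem radialCutoff_mem_Icc (ε : ℝ) (x : E) : radialCutoff ε x ∈ Set.Icc (0 : ℝ) 1 :=
  ⟨le_max_left _ _, max_le zero_le_one (min_le_left _ _)⟩

theorem lipschitzWith_radialCutoff (ε : ℝ) :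
    LipschitzWith ‖ε⁻¹‖₊ (radialCutoff ε : E → ℝ) := by
  have h : LipschitzWith ‖ε⁻¹‖₊ (fun x : E => ε⁻¹ * (1 - ‖x‖)) := by
    refine LipschitzWith.of_dist_le_mul fun x y => ?_
    rw [Real.dist_eq, ← mul_sub, abs_mul, coe_nnnorm, Real.norm_eq_abs, dist_eq_norm,
      sub_sub_sub_cancel_left, abs_sub_comm]
    exact mul_le_mul_of_nonneg_left (abs_norm_sub_norm_le x y) (abs_nonneg _)
  exact (h.const_min 1).const_max 0

theorem hasCompactSupport_radialCutoff [ProperSpace E] {ε : ℝ} (hε : 0 < ε) :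
    HasCompactSupport (radialCutoff ε : E → ℝ) :=
  HasCompactSupport.intro (isCompact_closedBall 0 1) fun x hx =>
    radialCutoff_of_one_le_norm hε (by simpa using (not_le.1 (by simpa using hx)).le)

variable [InnerProductSpace ℝ E]

theorem hasLineDerivAt_norm {x : E} (hx : x ≠ 0) (v : E) :
    HasLineDerivAt ℝ (fun y : E => ‖y‖) (inner ℝ (‖x‖⁻¹ • x) v) x v := by
  have h1 : HasFDerivAt (fun y : E => ‖y‖ ^ 2) (2 • innerSL ℝ x) x :=
    (hasStrictFDerivAt_norm_sq x).hasFDerivAt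
  have h2 := (h1.sqrt (by positivity)).hasLineDerivAt v
  simp only [Real.sqrt_sq (norm_nonneg _)] at h2
  convert h2 using 1
  simp [inner_smul_left]
  field_simp

theorem norm_inv_norm_smul_self_le (x : E) : ‖‖x‖⁻¹ • x‖ ≤ 1 := by
  rw [norm_smul, norm_inv, norm_norm]
  exact inv_mul_le_one

theorem inv_norm_smul_self_smul {r : ℝ} (hr : 0 < r) (x : E) :
    ‖r • x‖⁻¹ • r • x = ‖x‖⁻¹ • x := by
  rw [norm_smul, Real.norm_of_nonneg hr.le, smul_smul, mul_inv, mul_right_comm,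
    inv_mul_cancel₀ hr.ne', one_mul]

theorem lineDeriv_radialCutoff {ε : ℝ} (hε : 0 < ε) (hε1 : ε < 1) {x : E}
    (h1 : ‖x‖ ≠ 1) (h2 : ‖x‖ ≠ 1 - ε) (v : E) :
    lineDeriv ℝ (radialCutoff ε) x v =
      (Metric.closedBall (0 : E) 1 \ Metric.closedBall 0 (1 - ε)).indicator
        (fun x => -(ε⁻¹ * inner ℝ (‖x‖⁻¹ • x) v)) x := by
  have hc : Continuous (fun y : E => ‖y‖) := continuous_norm
  rcases lt_or_gt_of_ne h2 with h | h
  · have he : radialCutoff ε =ᶠ[nhds x] fun _ => (1 : ℝ) := by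
      filter_upwards [hc.continuousAt.eventually_lt continuousAt_const h] with y hy
      exact radialCutoff_of_norm_le hε hy.le
    rw [he.lineDeriv_eq, (hasFDerivAt_const _ x).hasLineDerivAt v |>.lineDeriv,
      Set.indicator_of_notMem]
    · simp
    · simp [h.le]
  rcases lt_or_gt_of_ne h1 with h' | h'
  · have he : radialCutoff ε =ᶠ[nhds x] fun y => ε⁻¹ * (1 - ‖y‖) := by
      filter_upwards [hc.continuousAt.eventually_lt continuousAt_const h',
        continuousAt_const.eventually_lt hc.continuousAt h] with y hy hy'
      exact radialCutoff_of_mem hε hy'.le hy.le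
    have hx : x ≠ 0 := by
      rintro rfl
      simp at h
      linarith
    rw [he.lineDeriv_eq, Set.indicator_of_mem (by simp [h, h'.le])]
    have hd : HasLineDerivAt ℝ (fun y : E => ε⁻¹ * (1 - ‖y‖))
        (ε⁻¹ * (-(inner ℝ (‖x‖⁻¹ • x) v))) x v := by
      have := hasLineDerivAt_norm hx v
      unfold HasLineDerivAt at this ⊢
      exact (this.const_sub 1).const_mul _
    rw [hd.lineDeriv, mul_neg]
  · have he : radialCutoff ε =ᶠ[nhds x] fun _ => (0 : ℝ) := by
      filter_upwards [continuousAt_const.eventually_lt hc.continuousAt h'] with y hy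
      exact radialCutoff_of_one_le_norm hε hy.le
    rw [he.lineDeriv_eq, (hasFDerivAt_const _ x).hasLineDerivAt v |>.lineDeriv,
      Set.indicator_of_notMem]
    · simp
    · simp [h']

variable [FiniteDimensional ℝ E] [MeasurableSpace E] [BorelSpace E]

theorem measurable_inv_norm_smul_self : Measurable (fun x : E => ‖x‖⁻¹ • x) :=
  measurable_norm.inv.smul measurable_id

variable (μ : Measure E) [μ.IsAddHaarMeasure]

theorem setIntegral_unitBall_sdiff_of_comp_smul {ε : ℝ} (hε : 0 < ε) (hε1 : ε < 1) {H : E → ℝ}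
    (hH : ∀ r : ℝ, 0 < r → ∀ x, H (r • x) = H x)
    (hint : IntegrableOn H (Metric.closedBall 0 1) μ) :
    ∫ x in Metric.closedBall (0 : E) 1 \ Metric.closedBall 0 (1 - ε), H x ∂μ =
      (1 - (1 - ε) ^ Module.finrank ℝ E) * ∫ x in Metric.closedBall (0 : E) 1, H x ∂μ := by
  have hr : 0 < 1 - ε := by linarith
  rw [setIntegral_sdiff Metric.isClosed_closedBall.measurableSet hint
    (Metric.closedBall_subset_closedBall (by linarith))]
  have h := Measure.setIntegral_comp_smul_of_pos μ H (Metric.closedBall (0 : E) 1) hr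
  simp only [hH _ hr] at h
  rw [smul_unitClosedBall_of_nonneg hr.le, smul_eq_mul, eq_inv_mul_iff_mul_eq₀ (by positivity)] at h
  rw [← h]
  ring

theorem integrableOn_comp_inv_norm_smul_self {F : Type*} [NormedAddCommGroup F] {G : E → F}
    (hG : Continuous G) :
    IntegrableOn (fun x => G (‖x‖⁻¹ • x)) (Metric.closedBall 0 1) μ := by
  obtain ⟨M, hM⟩ := (isCompact_closedBall (0 : E) 1).exists_bound_of_continuousOn hG.continuousOn
  refine Measure.integrableOn_of_bounded (M := M) measure_closedBall_lt_top.ne ?_ ?_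
  · exact (hG.stronglyMeasurable.comp_measurable measurable_inv_norm_smul_self).aestronglyMeasurable
  · exact .of_forall fun x => hM _ (by simpa using norm_inv_norm_smul_self_le x)

theorem integral_lineDeriv_mul_radialCutoff [Nontrivial E] {C : NNReal} {F : E → ℝ}
    (hF : LipschitzWith C F) (v : E) {ε : ℝ} (hε : 0 < ε) (hε1 : ε < 1) :
    ∫ x, lineDeriv ℝ F x v * radialCutoff ε x ∂μ =
      ε⁻¹ * ∫ x in Metric.closedBall (0 : E) 1 \ Metric.closedBall 0 (1 - ε),
        F x * inner ℝ (‖x‖⁻¹ • x) v ∂μ := by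
  rw [hF.integral_lineDeriv_mul_eq (lipschitzWith_radialCutoff ε)
    (hasCompactSupport_radialCutoff hε), ← integral_const_mul, ← integral_indicator
    (Metric.isClosed_closedBall.measurableSet.diff Metric.isClosed_closedBall.measurableSet)]
  refine integral_congr_ae ?_
  have hs (r : ℝ) : ∀ᵐ x ∂μ, ‖x‖ ≠ r := by
    rw [ae_iff]
    convert Measure.addHaar_sphere μ (0 : E) r using 2
    ext; simp
  filter_upwards [hs 1, hs (1 - ε)] with x h1 h2
  rw [lineDeriv_radialCutoff hε hε1 h1 h2]
  simp only [Set.indicator]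
  split_ifs
  · rw [inner_neg_right]; ring
  · simp

theorem abs_integral_lineDeriv_mul_radialCutoff_sub_le {C : NNReal} {F : E → ℝ}
    (hF : LipschitzWith C F) (v : E) {ε : ℝ} (hε : 0 < ε) :
    |∫ x, lineDeriv ℝ F x v * radialCutoff ε x ∂μ -
        ∫ x in Metric.closedBall (0 : E) 1, lineDeriv ℝ F x v ∂μ| ≤
      C * ‖v‖ * μ.real (Metric.closedBall (0 : E) 1 \ Metric.closedBall 0 (1 - ε)) := by
  have hB : MeasurableSet (Metric.closedBall (0 : E) 1) := Metric.isClosed_closedBall.measurableSet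
  have hA : MeasurableSet (Metric.closedBall (0 : E) 1 \ Metric.closedBall 0 (1 - ε)) :=
    hB.diff Metric.isClosed_closedBall.measurableSet
  have hloc := hF.locallyIntegrable_lineDeriv (μ := μ) v
  have hi1 : Integrable (fun x => lineDeriv ℝ F x v * radialCutoff ε x) μ :=
    hloc.integrable_smul_right_of_hasCompactSupport (lipschitzWith_radialCutoff ε).continuous
      (hasCompactSupport_radialCutoff hε)
  have hi2 : IntegrableOn (fun x => lineDeriv ℝ F x v) (Metric.closedBall 0 1) μ :=
    hloc.integrableOn_isCompact (isCompact_closedBall _ _)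
  rw [← integral_indicator hB, ← integral_sub hi1 (hi2.integrable_indicator hB), mul_comm,
    ← smul_eq_mul (a := μ.real _), ← setIntegral_const, ← integral_indicator hA]
  rw [← Real.norm_eq_abs]
  refine norm_integral_le_of_norm_le (IntegrableOn.integrable_indicator (integrableOn_const
    ((measure_mono Set.sdiff_subset).trans_lt measure_closedBall_lt_top).ne) hA) (.of_forall fun x => ?_)
  have hd : ‖lineDeriv ℝ F x v‖ ≤ C * ‖v‖ := norm_lineDeriv_le_of_lipschitz ℝ hF
  by_cases h1 : ‖x‖ ≤ 1
  · rw [Set.indicator_of_mem (s := Metric.closedBall 0 1) (by simpa using h1)]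
    by_cases h2 : ‖x‖ ≤ 1 - ε
    · rw [radialCutoff_of_norm_le hε h2, mul_one, sub_self, norm_zero]
      exact Set.indicator_nonneg (fun _ _ => by positivity) _
    · rw [Set.indicator_of_mem (by simpa [h1] using h2), ← mul_sub_one, norm_mul]
      have := radialCutoff_mem_Icc ε x
      refine (mul_le_of_le_one_right (norm_nonneg _) ?_).trans hd
      rw [Real.norm_eq_abs, abs_le]
      constructor <;> linarith [this.1, this.2]
  · rw [Set.indicator_of_notMem (s := Metric.closedBall 0 1) (by simpa using h1),
      radialCutoff_of_one_le_norm hε (not_le.1 h1).le]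
    simp only [mul_zero, sub_zero, norm_zero]
    exact Set.indicator_nonneg (fun _ _ => by positivity) _

theorem abs_setIntegral_mul_inner_sub_le {C : NNReal} {F : E → ℝ}
    (hF : LipschitzWith C F) (v : E) {ε : ℝ} (hε1 : ε < 1) :
    |∫ x in Metric.closedBall (0 : E) 1 \ Metric.closedBall 0 (1 - ε),
          F x * inner ℝ (‖x‖⁻¹ • x) v ∂μ -
        ∫ x in Metric.closedBall (0 : E) 1 \ Metric.closedBall 0 (1 - ε),
          F (‖x‖⁻¹ • x) * inner ℝ (‖x‖⁻¹ • x) v ∂μ| ≤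
      C * ε * ‖v‖ * μ.real (Metric.closedBall (0 : E) 1 \ Metric.closedBall 0 (1 - ε)) := by
  have hfin : μ (Metric.closedBall (0 : E) 1 \ Metric.closedBall 0 (1 - ε)) < ⊤ :=
    (measure_mono Set.sdiff_subset).trans_lt measure_closedBall_lt_top
  have hi2 : IntegrableOn (fun x => F (‖x‖⁻¹ • x) * inner ℝ (‖x‖⁻¹ • x) v)
      (Metric.closedBall (0 : E) 1 \ Metric.closedBall 0 (1 - ε)) μ :=
    (integrableOn_comp_inv_norm_smul_self μ (G := fun u => F u * inner ℝ u v)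
      (hF.continuous.mul (by fun_prop))).mono_set Set.sdiff_subset
  have hi1 : IntegrableOn (fun x => F x * inner ℝ (‖x‖⁻¹ • x) v)
      (Metric.closedBall (0 : E) 1 \ Metric.closedBall 0 (1 - ε)) μ := by
    refine IntegrableOn.mono_set ?_ Set.sdiff_subset
    exact (integrableOn_comp_inv_norm_smul_self μ (G := fun u => inner ℝ u v)
      (by fun_prop)).continuousOn_mul hF.continuous.continuousOn (isCompact_closedBall _ _)
  rw [← integral_sub hi1 hi2, ← Real.norm_eq_abs]
  refine norm_setIntegral_le_of_norm_le_const hfin fun x hx => ?_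
  have h1 : ‖x‖ ≤ 1 := by simpa using hx.1
  have h2 : 1 - ε < ‖x‖ := by simpa using hx.2
  have h0 : 0 < ‖x‖ := by linarith
  rw [← sub_mul, norm_mul]
  have hFx : ‖F x - F (‖x‖⁻¹ • x)‖ ≤ C * ε := by
    refine (hF.norm_sub_le _ _).trans (mul_le_mul_of_nonneg_left ?_ C.coe_nonneg)
    have : x - ‖x‖⁻¹ • x = (1 - ‖x‖⁻¹) • x := by rw [sub_smul, one_smul]
    rw [this, norm_smul, ← norm_norm x, ← norm_mul, norm_norm, sub_mul, one_mul,
      inv_mul_cancel₀ h0.ne', Real.norm_eq_abs, abs_le]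
    constructor <;> linarith
  refine mul_le_mul hFx ?_ (norm_nonneg _) ((norm_nonneg _).trans hFx)
  refine (norm_inner_le_norm _ _).trans ?_
  exact mul_le_of_le_one_left (norm_nonneg _) (norm_inv_norm_smul_self_le x)

/-- The divergence theorem on the unit ball for a Lipschitz function and a constant direction, with
the surface integral written as an integral over the ball of a function of `x / ‖x‖`. -/
theorem setIntegral_unitBall_lineDeriv [Nontrivial E] {C : NNReal} {F : E → ℝ}
    (hF : LipschitzWith C F) (v : E) :
    ∫ x in Metric.closedBall (0 : E) 1, lineDeriv ℝ F x v ∂μ =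
      Module.finrank ℝ E * ∫ x in Metric.closedBall (0 : E) 1,
        F (‖x‖⁻¹ • x) * inner ℝ (‖x‖⁻¹ • x) v ∂μ := by
  set J := ∫ x in Metric.closedBall (0 : E) 1, F (‖x‖⁻¹ • x) * inner ℝ (‖x‖⁻¹ • x) v ∂μ with hJ
  set I := ∫ x in Metric.closedBall (0 : E) 1, lineDeriv ℝ F x v ∂μ
  set n := Module.finrank ℝ E
  set V := μ.real (Metric.closedBall (0 : E) 1)
  have key (ε : ℝ) (hε : 0 < ε) (hε1 : ε < 1) :
      |I - ε⁻¹ * (1 - (1 - ε) ^ n) * J| ≤ 2 * C * ‖v‖ * ((1 - (1 - ε) ^ n) * V) := by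
    have hA : μ.real (Metric.closedBall (0 : E) 1 \ Metric.closedBall 0 (1 - ε)) =
        (1 - (1 - ε) ^ n) * V := by
      simpa using setIntegral_unitBall_sdiff_of_comp_smul μ hε hε1 (H := fun _ => 1)
        (fun _ _ _ => rfl) (integrableOn_const measure_closedBall_lt_top.ne)
    have hc := setIntegral_unitBall_sdiff_of_comp_smul μ hε hε1
      (H := fun x => F (‖x‖⁻¹ • x) * inner ℝ (‖x‖⁻¹ • x) v)
      (fun r hr x => by simp only [inv_norm_smul_self_smul hr])
      (integrableOn_comp_inv_norm_smul_self μ (G := fun u => F u * inner ℝ u v)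
        (hF.continuous.mul (by fun_prop)))
    have ha := abs_integral_lineDeriv_mul_radialCutoff_sub_le μ hF v hε
    have hb := abs_setIntegral_mul_inner_sub_le μ hF v hε1
    rw [integral_lineDeriv_mul_radialCutoff μ hF v hε hε1, hA] at ha
    rw [hc, hA, ← hJ] at hb
    have hb' := mul_le_mul_of_nonneg_left hb (inv_nonneg.2 hε.le)
    rw [← abs_of_nonneg (inv_nonneg.2 hε.le), ← abs_mul, abs_of_nonneg (inv_nonneg.2 hε.le),
      mul_sub] at hb'
    have he : ε⁻¹ * (C * ε * ‖v‖ * ((1 - (1 - ε) ^ n) * V)) =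
        C * ‖v‖ * ((1 - (1 - ε) ^ n) * V) := by field_simp
    rw [he, ← mul_assoc ε⁻¹] at hb'
    rw [abs_le] at ha hb' ⊢
    constructor <;> linarith [ha.1, ha.2, hb'.1, hb'.2]
  have hpow : Filter.Tendsto (fun ε : ℝ => 1 - (1 - ε) ^ n)
      (nhdsWithin 0 (Set.Ioi 0)) (nhds 0) := by
    have : Continuous (fun ε : ℝ => 1 - (1 - ε) ^ n) := by fun_prop
    simpa using (this.tendsto 0).mono_left nhdsWithin_le_nhds
  have hslope : Filter.Tendsto (fun ε : ℝ => ε⁻¹ * (1 - (1 - ε) ^ n))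
      (nhdsWithin 0 (Set.Ioi 0)) (nhds n) := by
    have hd : HasDerivAt (fun ε : ℝ => 1 - (1 - ε) ^ n) n 0 := by
      simpa using ((((hasDerivAt_id (0 : ℝ)).const_sub 1).pow n).const_sub 1)
    simpa using hd.tendsto_slope_zero_right
  have hl : Filter.Tendsto (fun ε : ℝ => |I - ε⁻¹ * (1 - (1 - ε) ^ n) * J|)
      (nhdsWithin 0 (Set.Ioi 0)) (nhds |I - n * J|) :=
    ((hslope.mul_const J).const_sub I).abs
  have hr : Filter.Tendsto (fun ε : ℝ => 2 * C * ‖v‖ * ((1 - (1 - ε) ^ n) * V))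
      (nhdsWithin 0 (Set.Ioi 0)) (nhds 0) := by
    simpa using (hpow.mul_const V).const_mul (2 * C * ‖v‖)
  have hle : |I - n * J| ≤ 0 := le_of_tendsto_of_tendsto hl hr <| by
    filter_upwards [Ioo_mem_nhdsGT (zero_lt_one' ℝ)] with ε hε
    exact key ε hε.1 hε.2
  exact sub_eq_zero.1 (abs_eq_zero.1 (le_antisymm hle (abs_nonneg _)))

theorem quasiMeasurePreserving_add_smul (x : E) {δ : ℝ} (hδ : δ ≠ 0) :
    Measure.QuasiMeasurePreserving (fun v : E => x + δ • v) μ μ :=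
  (measurePreserving_add_left μ x).quasiMeasurePreserving.comp
    (Measure.quasiMeasurePreserving_smul μ hδ)

end UnitBall

theorem integral_ballUniform (d : ℕ) {G : Type*} [NormedAddCommGroup G] [NormedSpace ℝ G]
    (g : EuclideanSpace ℝ (Fin d) → G) :
    ∫ v, g v ∂(ballUniform d) =
      (volume.real (Metric.closedBall (0 : EuclideanSpace ℝ (Fin d)) 1))⁻¹ •
        ∫ v in Metric.closedBall (0 : EuclideanSpace ℝ (Fin d)) 1, g v := by
  rw [ballUniform, integral_smul_measure, ENNReal.toReal_inv, Measure.real]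

theorem integral_sphereUniform (d : ℕ) {G : Type*} [NormedAddCommGroup G] [NormedSpace ℝ G]
    {g : EuclideanSpace ℝ (Fin d) → G} (hg : Continuous g) :
    ∫ u, g u ∂(sphereUniform d) = ∫ v, g (‖v‖⁻¹ • v) ∂(ballUniform d) :=
  integral_map measurable_inv_norm_smul_self.aemeasurable hg.aestronglyMeasurable

/-- Rademacher's theorem lets one differentiate the smoothed function under the integral sign. -/
theorem hasFDerivAt_smoothed (d : ℕ) {C : NNReal} {δ : ℝ} (hδ : 0 < δ)
    {f : EuclideanSpace ℝ (Fin d) → ℝ} (hf : LipschitzWith C f) (x : EuclideanSpace ℝ (Fin d)) :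
    Integrable (fun v => fderiv ℝ f (x + δ • v)) (ballUniform d) ∧
      HasFDerivAt (smoothed d f δ) (∫ v, fderiv ℝ f (x + δ • v) ∂(ballUniform d)) x := by
  have hV : volume (Metric.closedBall (0 : EuclideanSpace ℝ (Fin d)) 1) ≠ 0 :=
    (Metric.measure_closedBall_pos _ _ one_pos).ne'
  have hac : ballUniform d ≪ volume :=
    (Measure.smul_absolutelyContinuous).trans Measure.absolutelyContinuous_restrict
  have hint {G : Type} [NormedAddCommGroup G] {g : EuclideanSpace ℝ (Fin d) → G}
      (hg : Continuous g) : Integrable g (ballUniform d) :=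
    ((hg.continuousOn.integrableOn_compact (isCompact_closedBall _ _))).smul_measure
      (ENNReal.inv_ne_top.2 hV)
  refine hasFDerivAt_integral_of_dominated_loc_of_lip (s := Set.univ)
    (bound := fun _ => (C : ℝ)) Filter.univ_mem ?_ ?_ ?_ ?_ ?_ ?_
  · refine .of_forall fun y => Continuous.aestronglyMeasurable ?_
    exact hf.continuous.comp (by fun_prop)
  · exact hint (hf.continuous.comp (by fun_prop))
  · exact ((measurable_fderiv ℝ f).comp (by fun_prop)).aestronglyMeasurable
  · refine .of_forall fun v => LipschitzOnWith.of_dist_le_mul fun y _ z _ => ?_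
    simpa using hf.dist_le_mul (y + δ • v) (z + δ • v)
  · exact hint continuous_const
  · refine hac.ae_le ?_
    filter_upwards [(quasiMeasurePreserving_add_smul volume x hδ.ne').ae
      hf.ae_differentiableAt] with v hv
    exact (hasFDerivAt_comp_add_right (δ • v)).2 hv.hasFDerivAt

/-- If `f` is `L`-Lipschitz, then the smoothed function `f_δ` is differentiable everywhere
with gradient `∇f_δ(x) = (d/δ) · E_{u ~ uniform sphere}[f(x + δu) u]`. -/
theorem stmt1 (d : ℕ) (hd : 1 ≤ d) (L δ : ℝ) (hL : 0 ≤ L) (hδ : 0 < δ)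
    (f : EuclideanSpace ℝ (Fin d) → ℝ)
    (hf : ∀ x y, |f x - f y| ≤ L * ‖x - y‖)
    (x : EuclideanSpace ℝ (Fin d)) :
    HasGradientAt (smoothed d f δ)
      (((d : ℝ) / δ) • ∫ u, f (x + δ • u) • u ∂(sphereUniform d)) x := by
  have : Nonempty (Fin d) := ⟨⟨0, hd⟩⟩
  have hlip : LipschitzWith L.toNNReal f := .of_dist_le_mul fun y z => by
    simpa [Real.dist_eq, dist_eq_norm, hL] using hf y z
  obtain ⟨hint, hder⟩ := hasFDerivAt_smoothed d hδ hlip x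
  suffices hgrad : InnerProductSpace.toDual ℝ _
      (((d : ℝ) / δ) • ∫ u, f (x + δ • u) • u ∂(sphereUniform d)) =
        ∫ v, fderiv ℝ f (x + δ • v) ∂(ballUniform d) by
    rw [hasGradientAt_iff_hasFDerivAt, hgrad]
    exact hder
  have hF : LipschitzWith (L.toNNReal * ‖δ‖₊) (fun v => f (x + δ • v)) :=
    hlip.comp (.of_dist_le_mul fun y z => by simp [dist_smul₀])
  have hcont : Continuous fun u => f (x + δ • u) • u := hF.continuous.smul continuous_id
  have hi : IntegrableOn (fun v : EuclideanSpace ℝ (Fin d) =>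
      f (x + δ • ‖v‖⁻¹ • v) • ‖v‖⁻¹ • v) (Metric.closedBall 0 1) :=
    integrableOn_comp_inv_norm_smul_self volume hcont
  have hline (h : EuclideanSpace ℝ (Fin d)) :
      (fun v => lineDeriv ℝ (fun v => f (x + δ • v)) v h) =ᵐ[volume]
        fun v => δ * fderiv ℝ f (x + δ • v) h := by
    filter_upwards [(quasiMeasurePreserving_add_smul volume x hδ.ne').ae
      hlip.ae_differentiableAt] with v hv
    have h1 : HasFDerivAt (fun v : EuclideanSpace ℝ (Fin d) => x + δ • v)
        (δ • ContinuousLinearMap.id ℝ _) v := ((hasFDerivAt_id v).const_smul δ).const_add x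
    simpa [Function.comp_def] using ((hv.hasFDerivAt.comp v h1).hasLineDerivAt h).lineDeriv
  ext1 h
  have hdiv := setIntegral_unitBall_lineDeriv volume hF h
  rw [integral_congr_ae (ae_restrict_of_ae (hline h)), integral_const_mul,
    finrank_euclideanSpace_fin] at hdiv
  rw [ContinuousLinearMap.integral_apply hint, integral_sphereUniform d hcont,
    integral_ballUniform, integral_ballUniform, InnerProductSpace.toDual_apply_apply,
    inner_smul_left, inner_smul_left, real_inner_comm, ← integral_inner hi]
  simp only [real_inner_comm, inner_smul_left, inner_smul_right] at hdiv ⊢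
  simp only [conj_trivial, smul_eq_mul] at hdiv ⊢
  rw [mul_left_comm, div_mul_eq_mul_div, ← hdiv, mul_div_cancel_left₀ _ hδ.ne']
end

section
/- Let d ≥ 1 and T ≥ 1 be integers, R > 0, L > 0, and set η = R/(L√(dT)) and δ = R√(d/T). Let f_t, f_{t−1} : ℝ^d → ℝ be arbitrary functions, let x_t, x_{t−1} ∈ ℝ^d, let u_t, u_{t−1} be unit vectors in ℝ^d, and set w_t = x_t + δu_t and w_{t−1} = x_{t−1} + δu_{t−1}, assuming w_t ≠ w_{t−1}. Suppose v ∈ ℝ^d satisfies ‖x_t − x_{t−1}‖ ≤ η‖v‖ and ‖v‖² ≤ d²L², and suppose the temporal variation condition (f_t(w_t) − f_{t−1}(w_{t−1}))² / ‖w_t − w_{t−1}‖² < L²/(10d) holds. Then the one-point residual gradient estimator g = (d/δ)(f_t(w_t) − f_{t−1}(w_{t−1})) u_t satisfies ‖g‖² < dL². -/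
/-- Lemma 2 (reduced norms): with `η = R/(L√(dT))`, `δ = R√(d/T)`, if the previous
gradient is bounded by `d²L²` and the temporal variation is below `L²/(10d)`, then the
one-point residual gradient estimator satisfies `‖g‖² < dL²`. -/
theorem stmt4 (d T : ℕ) (hd : 1 ≤ d) (hT : 1 ≤ T) (R L : ℝ) (hR : 0 < R) (hL : 0 < L)
    (η δ : ℝ) (hη : η = R / (L * Real.sqrt (d * T))) (hδ : δ = R * Real.sqrt (d / T))
    (ft ftm : EuclideanSpace ℝ (Fin d) → ℝ)
    (xt xtm ut utm : EuclideanSpace ℝ (Fin d))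
    (hut : ‖ut‖ = 1) (hutm : ‖utm‖ = 1)
    (hne : xt + δ • ut ≠ xtm + δ • utm)
    (v : EuclideanSpace ℝ (Fin d)) (hv : ‖xt - xtm‖ ≤ η * ‖v‖)
    (hvbound : ‖v‖ ^ 2 ≤ (d : ℝ) ^ 2 * L ^ 2)
    (hvar : (ft (xt + δ • ut) - ftm (xtm + δ • utm)) ^ 2 /
        ‖(xt + δ • ut) - (xtm + δ • utm)‖ ^ 2 < L ^ 2 / (10 * d)) :
    ‖((d : ℝ) / δ * (ft (xt + δ • ut) - ftm (xtm + δ • utm))) • ut‖ ^ 2 <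
      (d : ℝ) * L ^ 2 := by
  have hd0 : (0 : ℝ) < d := by exact_mod_cast hd
  have hT0 : (0 : ℝ) < T := by exact_mod_cast hT
  have hδ0 : 0 < δ := by rw [hδ]; positivity
  have hη0 : 0 ≤ η := by rw [hη]; positivity
  have hηδ : η * (d * L) = δ := by
    have hs : 0 < Real.sqrt d := Real.sqrt_pos.mpr hd0
    have ht : 0 < Real.sqrt T := Real.sqrt_pos.mpr hT0
    have hsq : Real.sqrt d ^ 2 = d := Real.sq_sqrt hd0.le
    rw [hη, hδ, Real.sqrt_mul hd0.le, Real.sqrt_div hd0.le]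
    field_simp
    exact hsq.symm
  have hvle : ‖v‖ ≤ d * L := by
    refine (pow_le_pow_iff_left₀ (norm_nonneg v) (by positivity) two_ne_zero).mp ?_
    rwa [mul_pow]
  have hx : ‖xt - xtm‖ ≤ δ :=
    hv.trans (hηδ ▸ mul_le_mul_of_nonneg_left hvle hη0)
  have hw : ‖(xt + δ • ut) - (xtm + δ • utm)‖ ≤ 3 * δ := by
    calc ‖(xt + δ • ut) - (xtm + δ • utm)‖
        = ‖(xt - xtm) + (δ • ut - δ • utm)‖ := by rw [add_sub_add_comm]
      _ ≤ ‖xt - xtm‖ + (‖δ • ut‖ + ‖δ • utm‖) :=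
          (norm_add_le _ _).trans (add_le_add_right (norm_sub_le _ _) _)
      _ ≤ 3 * δ := by
          rw [norm_smul, norm_smul, hut, hutm, Real.norm_of_nonneg hδ0.le]
          linarith
  have hw0 : 0 < ‖(xt + δ • ut) - (xtm + δ • utm)‖ := norm_pos_iff.mpr (sub_ne_zero.mpr hne)
  rw [div_lt_iff₀ (by positivity)] at hvar
  have hdiff : (ft (xt + δ • ut) - ftm (xtm + δ • utm)) ^ 2 <
      L ^ 2 / (10 * d) * (3 * δ) ^ 2 :=
    hvar.trans_le (by gcongr)
  rw [norm_smul, hut, mul_one, Real.norm_eq_abs, sq_abs, mul_pow]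
  calc ((d : ℝ) / δ) ^ 2 * (ft (xt + δ • ut) - ftm (xtm + δ • utm)) ^ 2
      < (d / δ) ^ 2 * (L ^ 2 / (10 * d) * (3 * δ) ^ 2) := by gcongr
    _ = 9 / 10 * (d * L ^ 2) := by field_simp; norm_num
    _ < d * L ^ 2 := by
        have : 0 < d * L ^ 2 := by positivity
        linarith
end

section
/- There exists a universal constant c > 0 such that the following holds: for every integer d ≥ 1, every δ > 0, every L ≥ 0, every L-Lipschitz function f : ℝ^d → ℝ, every point x ∈ ℝ^d, and every measurable set A ⊆ 𝕊 that is symmetric (A = −A), one has E_u[(d²/(4δ²))·(f(x + δu) − f(x − δu))²·1_A(u)] ≤ c·d·L²·√(σ(A)), where u is distributed according to σ. -/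
open MeasureTheory

open ProbabilityTheory in
/-- The standard Gaussian measure has a density that depends only on the norm. -/
theorem stdGaussian_eq_withDensity (E : Type*) [NormedAddCommGroup E] [InnerProductSpace ℝ E]
    [FiniteDimensional ℝ E] [MeasurableSpace E] [BorelSpace E] :
    stdGaussian E = (volume : Measure E).withDensity fun x =>
      ENNReal.ofReal (((2 * Real.pi) ^ (Module.finrank ℝ E / 2 : ℝ))⁻¹ *
        Real.exp (-(1 / 2) * ‖x‖ ^ 2)) := by
  have hpos : 0 < (2 * Real.pi) ^ (Module.finrank ℝ E / 2 : ℝ) := by positivity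
  have hI : ∫ x : E, Real.exp (-(1 / 2) * ‖x‖ ^ 2) =
      (2 * Real.pi) ^ (Module.finrank ℝ E / 2 : ℝ) := by
    rw [GaussianFourier.integral_rexp_neg_mul_sq_norm (by norm_num)]
    congr 1
    ring
  have hint : Integrable fun x : E => ((2 * Real.pi) ^ (Module.finrank ℝ E / 2 : ℝ))⁻¹ *
      Real.exp (-(1 / 2) * ‖x‖ ^ 2) := by
    refine Integrable.const_mul (Integrable.of_integral_ne_zero ?_) _
    rw [hI]
    exact hpos.ne'
  have : IsFiniteMeasure ((volume : Measure E).withDensity fun x =>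
      ENNReal.ofReal (((2 * Real.pi) ^ (Module.finrank ℝ E / 2 : ℝ))⁻¹ *
        Real.exp (-(1 / 2) * ‖x‖ ^ 2))) :=
    isFiniteMeasure_withDensity_ofReal hint.2
  refine Measure.ext_of_charFun ?_
  ext t
  rw [charFun_stdGaussian, charFun_apply,
    integral_withDensity_eq_integral_toReal_smul (by fun_prop) (by simp)]
  have key := GaussianFourier.integral_cexp_neg_mul_sq_norm_add (V := E) (b := 1 / 2)
    (by norm_num) Complex.I t
  have hcongr : ∀ x : E, (ENNReal.ofReal (((2 * Real.pi) ^ (Module.finrank ℝ E / 2 : ℝ))⁻¹ *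
      Real.exp (-(1 / 2) * ‖x‖ ^ 2))).toReal • Complex.exp (inner ℝ x t * Complex.I) =
      ((((2 * Real.pi) ^ (Module.finrank ℝ E / 2 : ℝ))⁻¹ : ℝ) : ℂ) *
        Complex.exp (-(1 / 2) * ‖x‖ ^ 2 + Complex.I * inner ℝ t x) := by
    intro x
    rw [ENNReal.toReal_ofReal (by positivity), Complex.real_smul, Complex.exp_add,
      real_inner_comm]
    push_cast
    rw [mul_comm Complex.I]
    ring
  simp_rw [hcongr]
  rw [integral_const_mul, key]
  have h2 : ((Real.pi : ℂ) / (1 / 2)) ^ (Module.finrank ℝ E / 2 : ℂ) =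
      (((2 * Real.pi) ^ (Module.finrank ℝ E / 2 : ℝ) : ℝ) : ℂ) := by
    rw [Complex.ofReal_cpow (by positivity)]
    push_cast
    congr 1
    ring
  rw [h2, ← mul_assoc, ← Complex.ofReal_mul, inv_mul_cancel₀ hpos.ne', Complex.I_sq]
  simp only [Complex.ofReal_one, one_mul]
  congr 1
  ring

/-- Integration in polar coordinates of the product of a radial and an angular function. -/
theorem lintegral_norm_mul_direction {E : Type*} [NormedAddCommGroup E] [NormedSpace ℝ E]
    [FiniteDimensional ℝ E] [MeasurableSpace E] [BorelSpace E] [Nontrivial E]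
    (μ : Measure E) [μ.IsAddHaarMeasure] {φ : ℝ → ENNReal} {H : E → ENNReal}
    (hφ : Measurable φ) (hH : Measurable H) :
    ∫⁻ x, φ ‖x‖ * H (‖x‖⁻¹ • x) ∂μ =
      (∫⁻ u, H u ∂μ.toSphere) *
        ∫⁻ r, φ r ∂(Measure.volumeIoiPow (Module.finrank ℝ E - 1)) := by
  rw [← lintegral_prod_mul (by fun_prop) (by fun_prop),
    ← μ.measurePreserving_homeomorphUnitSphereProd.lintegral_comp (by fun_prop)]
  simp only [homeomorphUnitSphereProd_apply_fst_coe, homeomorphUnitSphereProd_apply_snd_coe]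
  rw [lintegral_subtype_comap (measurableSet_singleton _).compl
    (fun x : E => H (‖x‖⁻¹ • x) * φ ‖x‖), restrict_compl_singleton]
  simp_rw [mul_comm]

theorem isProbabilityMeasure_ballUniform (d : ℕ) : IsProbabilityMeasure (ballUniform d) := by
  refine ⟨?_⟩
  rw [ballUniform, Measure.smul_apply, Measure.restrict_apply_univ, smul_eq_mul]
  exact ENNReal.inv_mul_cancel (Metric.measure_closedBall_pos _ _ one_pos).ne'
    measure_closedBall_lt_top.ne

theorem isProbabilityMeasure_sphereUniform (d : ℕ) : IsProbabilityMeasure (sphereUniform d) := by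
  have := isProbabilityMeasure_ballUniform d
  exact Measure.isProbabilityMeasure_map (by fun_prop)

/-- Integrating against a radial density decouples the norm from the direction, and the direction
is distributed according to `sphereUniform`. -/
theorem lintegral_withDensity_norm_mul_direction {d : ℕ} (hd : 1 ≤ d) {ρ φ : ℝ → ENNReal}
    {H : EuclideanSpace ℝ (Fin d) → ENNReal}
    (hρ : Measurable ρ) (hφ : Measurable φ) (hH : Measurable H) :
    ∫⁻ x, φ ‖x‖ * H (‖x‖⁻¹ • x)
        ∂((volume : Measure (EuclideanSpace ℝ (Fin d))).withDensity fun x => ρ ‖x‖) =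
      (∫⁻ x, φ ‖x‖ ∂((volume : Measure (EuclideanSpace ℝ (Fin d))).withDensity fun x => ρ ‖x‖)) *
        ∫⁻ u, H u ∂sphereUniform d := by
  have : Nonempty (Fin d) := ⟨⟨0, hd⟩⟩
  set V := volume (Metric.closedBall (0 : EuclideanSpace ℝ (Fin d)) 1)
  have hσ : ∀ G : EuclideanSpace ℝ (Fin d) → ENNReal, Measurable G →
      ∫⁻ u, G u ∂sphereUniform d = (∫⁻ u, G u.1 ∂(volume : Measure (EuclideanSpace ℝ (Fin d))).toSphere) *
        (V⁻¹ * ∫⁻ r, (Set.Iic 1).indicator 1 (r : ℝ) ∂(Measure.volumeIoiPow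
          (Module.finrank ℝ (EuclideanSpace ℝ (Fin d)) - 1))) := by
    intro G hG
    rw [sphereUniform, lintegral_map hG (by fun_prop), ballUniform, lintegral_smul_measure,
      mul_left_comm, ← lintegral_norm_mul_direction volume
        (measurable_one.indicator measurableSet_Iic) hG,
      ← lintegral_indicator Metric.isClosed_closedBall.measurableSet, smul_eq_mul]
    congr 2
    ext x
    by_cases hx : ‖x‖ ≤ 1 <;> simp [hx]
  have h1 := hσ 1 measurable_one
  have := isProbabilityMeasure_sphereUniform d
  simp only [Pi.one_apply, lintegral_one, measure_univ] at h1
  rw [lintegral_withDensity_eq_lintegral_mul _ (by fun_prop) (by fun_prop),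
    lintegral_withDensity_eq_lintegral_mul _ (by fun_prop) (by fun_prop)]
  have h2 := lintegral_norm_mul_direction (volume : Measure (EuclideanSpace ℝ (Fin d)))
    (hρ.mul hφ) hH
  have h3 := lintegral_norm_mul_direction (volume : Measure (EuclideanSpace ℝ (Fin d)))
    (hρ.mul hφ) (measurable_one (β := EuclideanSpace ℝ (Fin d)))
  simp only [Pi.mul_apply, Pi.one_apply, mul_one, lintegral_one] at h2 h3 ⊢
  simp_rw [← mul_assoc]
  rw [h2, h3, hσ H hH]
  set S := (volume : Measure (EuclideanSpace ℝ (Fin d))).toSphere Set.univ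
  set a := V⁻¹ * ∫⁻ r, (Set.Iic 1).indicator 1 (r : ℝ) ∂(Measure.volumeIoiPow
          (Module.finrank ℝ (EuclideanSpace ℝ (Fin d)) - 1))
  rw [mul_comm S, mul_assoc, mul_left_comm S, ← h1, mul_one, mul_comm]

/-- The radial, positively homogeneous extension of a Lipschitz function vanishing at the origin is
Lipschitz. -/
theorem abs_norm_mul_direction_sub_le {E : Type*} [NormedAddCommGroup E] [NormedSpace ℝ E]
    {h : E → ℝ} {K : ℝ} (hK : 0 ≤ K) (hh : ∀ x y, |h x - h y| ≤ K * ‖x - y‖) (h0 : h 0 = 0)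
    (x y : E) :
    |‖x‖ * h (‖x‖⁻¹ • x) - ‖y‖ * h (‖y‖⁻¹ • y)| ≤ 3 * K * ‖x - y‖ := by
  have hdir : ∀ z : E, ‖‖z‖⁻¹ • z‖ ≤ 1 := fun z => by
    rw [norm_smul, norm_inv, norm_norm]
    exact inv_mul_le_one
  have hself : ∀ z : E, ‖z‖ • ‖z‖⁻¹ • z = z := fun z => by
    rcases eq_or_ne z 0 with rfl | hz
    · simp
    · rw [smul_smul, mul_inv_cancel₀ (norm_ne_zero_iff.2 hz), one_smul]
  have hx : |h (‖x‖⁻¹ • x)| ≤ K := by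
    have := hh (‖x‖⁻¹ • x) 0
    rw [h0, sub_zero, sub_zero] at this
    nlinarith [hdir x]
  have hN : |‖x‖ - ‖y‖| ≤ ‖x - y‖ := abs_norm_sub_norm_le x y
  have h2 : ‖y‖ * ‖‖x‖⁻¹ • x - ‖y‖⁻¹ • y‖ ≤ 2 * ‖x - y‖ := by
    have e : ‖y‖ • (‖x‖⁻¹ • x - ‖y‖⁻¹ • y) = (‖y‖ - ‖x‖) • (‖x‖⁻¹ • x) + (x - y) := by
      rw [smul_sub, hself y, sub_smul, hself x]
      abel
    calc ‖y‖ * ‖‖x‖⁻¹ • x - ‖y‖⁻¹ • y‖ = ‖‖y‖ • (‖x‖⁻¹ • x - ‖y‖⁻¹ • y)‖ := by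
          rw [norm_smul, norm_norm]
      _ ≤ |‖y‖ - ‖x‖| * ‖‖x‖⁻¹ • x‖ + ‖x - y‖ := by
          rw [e]
          refine (norm_add_le _ _).trans_eq ?_
          rw [norm_smul (‖y‖ - ‖x‖), Real.norm_eq_abs]
      _ ≤ 2 * ‖x - y‖ := by
          rw [abs_sub_comm]
          nlinarith [hdir x, abs_nonneg (‖x‖ - ‖y‖)]
  have h3 := hh (‖x‖⁻¹ • x) (‖y‖⁻¹ • y)
  calc |‖x‖ * h (‖x‖⁻¹ • x) - ‖y‖ * h (‖y‖⁻¹ • y)|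
      = |(‖x‖ - ‖y‖) * h (‖x‖⁻¹ • x) + ‖y‖ * (h (‖x‖⁻¹ • x) - h (‖y‖⁻¹ • y))| := by
        congr 1
        ring
    _ ≤ |‖x‖ - ‖y‖| * |h (‖x‖⁻¹ • x)| + ‖y‖ * |h (‖x‖⁻¹ • x) - h (‖y‖⁻¹ • y)| := by
        refine (abs_add_le _ _).trans_eq ?_
        rw [abs_mul, abs_mul, abs_norm]
    _ ≤ ‖x - y‖ * K + K * (2 * ‖x - y‖) := by
        have h4 : ‖y‖ * |h (‖x‖⁻¹ • x) - h (‖y‖⁻¹ • y)| ≤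
            K * (‖y‖ * ‖‖x‖⁻¹ • x - ‖y‖⁻¹ • y‖) := by
          nlinarith [norm_nonneg y]
        have h5 : |‖x‖ - ‖y‖| * |h (‖x‖⁻¹ • x)| ≤ ‖x - y‖ * K := by gcongr
        nlinarith
    _ = 3 * K * ‖x - y‖ := by ring

theorem sum_range_pow_four_le (n : ℕ) (a : ℕ → ℝ) :
    (∑ k ∈ Finset.range n, a k) ^ 4 ≤ n ^ 3 * ∑ k ∈ Finset.range n, a k ^ 4 := by
  have h1 := sq_sum_le_card_mul_sum_sq (s := Finset.range n) (f := a)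
  have h2 := sq_sum_le_card_mul_sum_sq (s := Finset.range n) (f := fun k => a k ^ 2)
  simp only [Finset.card_range, ← pow_mul] at h1 h2
  calc (∑ k ∈ Finset.range n, a k) ^ 4 = ((∑ k ∈ Finset.range n, a k) ^ 2) ^ 2 := by ring
    _ ≤ (n * ∑ k ∈ Finset.range n, a k ^ 2) ^ 2 := by gcongr
    _ = n ^ 2 * (∑ k ∈ Finset.range n, a k ^ 2) ^ 2 := by ring
    _ ≤ n ^ 2 * (n * ∑ k ∈ Finset.range n, a k ^ 4) := by gcongr
    _ = n ^ 3 * ∑ k ∈ Finset.range n, a k ^ 4 := by ring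

open ProbabilityTheory

section Rotation

variable {E : Type*} [NormedAddCommGroup E] [NormedSpace ℝ E]

/-- The increment of a function of the first component under a rotation of angle `t`. -/
noncomputable def rotationIncrement (F : E → ℝ) (t : ℝ) (z : E × E) : ℝ :=
  F (ContinuousLinearMap.rotation t z).1 - F z.1

theorem abs_rotationIncrement_le {F : E → ℝ} {K : ℝ} (hK : 0 ≤ K)
    (hF : ∀ x y, |F x - F y| ≤ K * ‖x - y‖) (t : ℝ) (z : E × E) :
    |rotationIncrement F t z| ≤ K * |t| * (‖z.1‖ + ‖z.2‖) := by
  refine (hF _ _).trans ?_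
  rw [mul_assoc]
  gcongr
  have h1 : |Real.cos t - 1| ≤ |t| := by
    simpa using Real.abs_cos_sub_cos_le t 0
  have h2 : |Real.sin t| ≤ |t| := Real.abs_sin_le_abs
  have e : (ContinuousLinearMap.rotation t z).1 - z.1 =
      (Real.cos t - 1) • z.1 + Real.sin t • z.2 := by
    simp only [ContinuousLinearMap.rotation_apply]
    module
  rw [e, mul_add]
  refine (norm_add_le _ _).trans ?_
  rw [norm_smul, norm_smul, Real.norm_eq_abs, Real.norm_eq_abs]
  gcongr

theorem rotation_add_apply (s t : ℝ) (z : E × E) :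
    ContinuousLinearMap.rotation (s + t) z =
      ContinuousLinearMap.rotation s (ContinuousLinearMap.rotation t z) := by
  simp only [ContinuousLinearMap.rotation_apply, Real.cos_add, Real.sin_add]
  ext1 <;> module

theorem tendsto_mul_rotationIncrement {F : E → ℝ} {z : E × E}
    (hz : DifferentiableAt ℝ F z.1) :
    Filter.Tendsto (fun n : ℕ => (n : ℝ) * rotationIncrement F (Real.pi / n) z) Filter.atTop
      (nhds (Real.pi * fderiv ℝ F z.1 z.2)) := by
  have hγ : HasDerivAt (fun t : ℝ => (ContinuousLinearMap.rotation (Real.pi * t) z).1)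
      (Real.pi • z.2) 0 := by
    have hid : HasDerivAt (fun t : ℝ => Real.pi * t) Real.pi 0 := by
      simpa using (hasDerivAt_id (0 : ℝ)).const_mul Real.pi
    have := (hid.cos.smul_const z.1).add (hid.sin.smul_const z.2)
    simp only [mul_zero, Real.sin_zero, neg_zero, zero_mul, zero_smul, Real.cos_zero, one_mul,
      zero_add] at this
    exact this
  have hz' : HasFDerivAt F (fderiv ℝ F z.1)
      (ContinuousLinearMap.rotation (Real.pi * 0) z).1 := by
    simpa [ContinuousLinearMap.rotation_apply] using hz.hasFDerivAt
  have hcomp := (hz'.comp_hasDerivAt (0 : ℝ) hγ).tendsto_slope_zero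
  have hinv : Filter.Tendsto (fun n : ℕ => ((n : ℝ))⁻¹) Filter.atTop (nhdsWithin 0 {0}ᶜ) :=
    (tendsto_inv_atTop_nhdsGT_zero.comp tendsto_natCast_atTop_atTop).mono_right
      (nhdsWithin_mono _ fun x hx => ne_of_gt hx)
  have := hcomp.comp hinv
  simpa [Function.comp_def, rotationIncrement, div_eq_mul_inv,
    ContinuousLinearMap.rotation_apply] using this

end Rotation

section Gaussian

variable {E : Type*} [NormedAddCommGroup E] [InnerProductSpace ℝ E] [FiniteDimensional ℝ E]
  [MeasurableSpace E] [BorelSpace E]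

/-- The fourth moment of a linear form under the standard Gaussian measure. -/
theorem integral_dual_pow_four_stdGaussian (l : StrongDual ℝ E) :
    ∫ y, (l y) ^ 4 ∂stdGaussian E = ‖l‖ ^ 4 * ∫ z, z ^ 4 ∂gaussianReal 0 1 := by
  have hmap : (stdGaussian E).map l = (gaussianReal 0 1).map (‖l‖ * ·) := by
    rw [IsGaussian.map_eq_gaussianReal, gaussianReal_map_const_mul,
      integral_strongDual_stdGaussian, variance_dual_stdGaussian]
    congr 1
    · simp
    · ext
      simp
  calc ∫ y, (l y) ^ 4 ∂stdGaussian E = ∫ z, z ^ 4 ∂(stdGaussian E).map l := by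
        rw [integral_map (by fun_prop) (by fun_prop)]
    _ = ∫ z, (‖l‖ * z) ^ 4 ∂gaussianReal 0 1 := by
        rw [hmap, integral_map (by fun_prop) (by fun_prop)]
    _ = _ := by simp_rw [mul_pow, integral_const_mul]

theorem integrable_norm_pow_stdGaussian (n : ℕ) :
    Integrable (fun x : E => ‖x‖ ^ n) (stdGaussian E) :=
  (IsGaussian.memLp_id (stdGaussian E) n (by simp)).integrable_norm_pow'

theorem integral_norm_sq_stdGaussian :
    ∫ x, ‖x‖ ^ 2 ∂stdGaussian E = Module.finrank ℝ E := by
  let b := stdOrthonormalBasis ℝ E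
  have h1 : ∀ i, ∫ x, (inner ℝ (b i) x) ^ 2 ∂stdGaussian E = 1 := by
    intro i
    have hv := variance_dual_stdGaussian (innerSL ℝ (b i))
    rw [variance_of_integral_eq_zero (by fun_prop)
      (integral_strongDual_stdGaussian _)] at hv
    simpa using hv
  have hi : ∀ i, Integrable (fun x => (inner ℝ (b i) x) ^ 2) (stdGaussian E) := fun i =>
    Integrable.of_integral_ne_zero (by rw [h1]; exact one_ne_zero)
  simp_rw [← b.sum_sq_inner_right]
  rw [integral_finsetSum _ fun i _ => hi i]
  simp [h1]

theorem sq_finrank_le_integral_norm_pow_four_stdGaussian :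
    (Module.finrank ℝ E : ℝ) ^ 2 ≤ ∫ x, ‖x‖ ^ 4 ∂stdGaussian E := by
  set n : ℝ := (Module.finrank ℝ E : ℝ)
  have h2 := integral_norm_sq_stdGaussian (E := E)
  have i2 := integrable_norm_pow_stdGaussian (E := E) 2
  have i4 := integrable_norm_pow_stdGaussian (E := E) 4
  calc n ^ 2 = ∫ x, (2 * n * ‖x‖ ^ 2 - n ^ 2) ∂stdGaussian E := by
        rw [integral_sub (i2.const_mul _) (integrable_const _), integral_const_mul, h2]
        simp
        ring
    _ ≤ ∫ x, ‖x‖ ^ 4 ∂stdGaussian E := by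
        refine integral_mono ((i2.const_mul _).sub (integrable_const _)) i4 fun x => ?_
        simp only
        nlinarith [sq_nonneg (‖x‖ ^ 2 - n)]

theorem integrable_pow_four_of_abs_le_prod_stdGaussian {G : E × E → ℝ} {C : ℝ}
    (hG : AEStronglyMeasurable G ((stdGaussian E).prod (stdGaussian E)))
    (hC : ∀ z, |G z| ≤ C * (‖z.1‖ + ‖z.2‖)) :
    Integrable (fun z => G z ^ 4) ((stdGaussian E).prod (stdGaussian E)) := by
  have hint : Integrable (fun z : E × E => C ^ 4 * (8 * (‖z.1‖ ^ 4 + ‖z.2‖ ^ 4)))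
      ((stdGaussian E).prod (stdGaussian E)) :=
    ((((integrable_norm_pow_stdGaussian 4).comp_fst _).add
      ((integrable_norm_pow_stdGaussian 4).comp_snd _)).const_mul 8).const_mul _
  refine hint.mono' (hG.pow 4) (.of_forall fun z => ?_)
  rw [norm_pow, Real.norm_eq_abs]
  calc |G z| ^ 4 ≤ (C * (‖z.1‖ + ‖z.2‖)) ^ 4 := by gcongr; exact hC z
    _ = C ^ 4 * (‖z.1‖ + ‖z.2‖) ^ 4 := mul_pow _ _ _
    _ ≤ C ^ 4 * (8 * (‖z.1‖ ^ 4 + ‖z.2‖ ^ 4)) := by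
        have := add_pow_le (norm_nonneg z.1) (norm_nonneg z.2) 4
        norm_num at this
        gcongr

theorem measurePreserving_rotation_stdGaussian (t : ℝ) :
    MeasurePreserving (ContinuousLinearMap.rotation t : E × E → E × E)
      ((stdGaussian E).prod (stdGaussian E)) ((stdGaussian E).prod (stdGaussian E)) :=
  ⟨by fun_prop, IsGaussian.map_rotation_eq_self integral_id_stdGaussian t⟩

theorem integral_odd_pow_four_le_integral_rotationIncrement {F : E → ℝ} {K : ℝ} (hK : 0 ≤ K)
    (hF : ∀ x y, |F x - F y| ≤ K * ‖x - y‖) (hodd : ∀ x, F (-x) = -F x) {n : ℕ} (hn : n ≠ 0) :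
    16 * ∫ x, F x ^ 4 ∂stdGaussian E ≤
      ∫ z, (n * rotationIncrement F (Real.pi / n) z) ^ 4
        ∂(stdGaussian E).prod (stdGaussian E) := by
  have hFc : Continuous F := (LipschitzWith.of_dist_le' fun x y => by
    rw [Real.dist_eq, dist_eq_norm]
    exact hF x y).continuous
  have hcont : Continuous (rotationIncrement F (Real.pi / n)) := by
    unfold rotationIncrement
    fun_prop
  have hint := integrable_pow_four_of_abs_le_prod_stdGaussian
    hcont.aestronglyMeasurable (abs_rotationIncrement_le hK hF (Real.pi / n))
  have htel : ∀ z : E × E, ∑ k ∈ Finset.range n, rotationIncrement F (Real.pi / n)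
      (ContinuousLinearMap.rotation (k * (Real.pi / n)) z) = -2 * F z.1 := by
    intro z
    have := Finset.sum_range_sub
      (fun k : ℕ => F (ContinuousLinearMap.rotation (k * (Real.pi / n)) z).1) n
    have hnn : (n : ℝ) * (Real.pi / n) = Real.pi := by
      field_simp
    simp only [hnn, Nat.cast_zero, zero_mul] at this
    simp only [rotationIncrement, ← rotation_add_apply]
    have e : ∀ k : ℕ, Real.pi / n + k * (Real.pi / n) = ((k + 1 : ℕ) : ℝ) * (Real.pi / n) := by
      intro k
      push_cast
      ring
    simp_rw [e]
    rw [this]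
    simp only [ContinuousLinearMap.rotation_apply, Real.cos_pi, Real.sin_pi, Real.cos_zero,
      Real.sin_zero, zero_smul, add_zero, one_smul, neg_smul, hodd]
    ring
  have hik : ∀ k : ℕ, Integrable (fun z => rotationIncrement F (Real.pi / n)
      (ContinuousLinearMap.rotation (k * (Real.pi / n)) z) ^ 4)
      ((stdGaussian E).prod (stdGaussian E)) := fun k =>
    (measurePreserving_rotation_stdGaussian (k * (Real.pi / n))).integrable_comp_of_integrable hint
  have hIk : ∀ k : ℕ, ∫ z, rotationIncrement F (Real.pi / n)
      (ContinuousLinearMap.rotation (k * (Real.pi / n)) z) ^ 4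
        ∂(stdGaussian E).prod (stdGaussian E) =
      ∫ z, rotationIncrement F (Real.pi / n) z ^ 4 ∂(stdGaussian E).prod (stdGaussian E) := by
    intro k
    conv_rhs => rw [← (measurePreserving_rotation_stdGaussian (k * (Real.pi / n))).map_eq]
    rw [integral_map (by fun_prop) (by fun_prop)]
  calc 16 * ∫ x, F x ^ 4 ∂stdGaussian E
      = ∫ z, (-2 * F z.1) ^ 4 ∂(stdGaussian E).prod (stdGaussian E) := by
        rw [integral_fun_fst (fun x => (-2 * F x) ^ 4), ← integral_const_mul]
        simp only [mul_pow, probReal_univ, one_smul]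
        norm_num
    _ ≤ ∫ z, n ^ 3 * ∑ k ∈ Finset.range n, rotationIncrement F (Real.pi / n)
          (ContinuousLinearMap.rotation (k * (Real.pi / n)) z) ^ 4
          ∂(stdGaussian E).prod (stdGaussian E) := by
        refine integral_mono_of_nonneg (.of_forall fun z => by positivity)
          ((integrable_finsetSum _ fun k _ => hik k).const_mul _) (.of_forall fun z => ?_)
        simp only
        rw [← htel z]
        exact sum_range_pow_four_le n _
    _ = _ := by
        rw [integral_const_mul, integral_finsetSum _ fun k _ => hik k]
        simp_rw [hIk, mul_pow]
        rw [integral_const_mul]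
        simp only [Finset.sum_const, Finset.card_range, nsmul_eq_mul]
        ring

/-- Dimension-free fourth moment bound for odd Lipschitz functions under the standard Gaussian
measure, by integrating along rotations of a pair of independent copies. -/
theorem integral_odd_pow_four_stdGaussian_le {F : E → ℝ} {K : ℝ} (hK : 0 ≤ K)
    (hF : ∀ x y, |F x - F y| ≤ K * ‖x - y‖) (hodd : ∀ x, F (-x) = -F x) :
    16 * ∫ x, F x ^ 4 ∂stdGaussian E ≤
      (Real.pi * K) ^ 4 * ∫ z, z ^ 4 ∂gaussianReal 0 1 := by
  have hlip : LipschitzWith K.toNNReal F := LipschitzWith.of_dist_le' fun x y => by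
    rw [Real.dist_eq, dist_eq_norm]
    exact hF x y
  have hFc : Continuous F := hlip.continuous
  have hdiff : ∀ᵐ z ∂(stdGaussian E).prod (stdGaussian E), DifferentiableAt ℝ F z.1 := by
    refine Measure.quasiMeasurePreserving_fst.ae (p := fun x => DifferentiableAt ℝ F x) ?_
    rw [stdGaussian_eq_withDensity]
    exact (withDensity_absolutelyContinuous _ _).ae_le hlip.ae_differentiableAt
  have hcont : ∀ t, Continuous (rotationIncrement F t) := fun t => by
    unfold rotationIncrement
    fun_prop
  have hderiv : ∀ x, ‖fderiv ℝ F x‖ ≤ K := fun x => by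
    simpa [hK] using norm_fderiv_le_of_lipschitz ℝ hlip (x₀ := x)
  have hmeas : Measurable fun z : E × E => fderiv ℝ F z.1 z.2 :=
    (isBoundedBilinearMap_apply (𝕜 := ℝ) (E := E) (F := ℝ)).continuous.measurable.comp
      (((measurable_fderiv ℝ F).comp measurable_fst).prodMk measurable_snd)
  have hbound : ∀ (n : ℕ) (z : E × E),
      |(n : ℝ) * rotationIncrement F (Real.pi / n) z| ≤ K * Real.pi * (‖z.1‖ + ‖z.2‖) := by
    intro n z
    rcases eq_or_ne n 0 with rfl | hn
    · simp only [Nat.cast_zero, zero_mul, abs_zero]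
      positivity
    · rw [abs_mul, Nat.abs_cast]
      refine (mul_le_mul_of_nonneg_left (abs_rotationIncrement_le hK hF _ z)
        n.cast_nonneg).trans_eq ?_
      rw [abs_of_nonneg (by positivity)]
      field_simp
  have hdom := integrable_pow_four_of_abs_le_prod_stdGaussian (E := E)
    (G := fun z => K * Real.pi * (‖z.1‖ + ‖z.2‖)) (C := K * Real.pi)
    (Continuous.aestronglyMeasurable (by fun_prop))
    (fun z => (abs_of_nonneg (by positivity)).le)
  have hlim : Filter.Tendsto (fun n : ℕ => ∫ z, (n * rotationIncrement F (Real.pi / n) z) ^ 4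
      ∂(stdGaussian E).prod (stdGaussian E)) Filter.atTop
      (nhds (∫ z, (Real.pi * fderiv ℝ F z.1 z.2) ^ 4
        ∂(stdGaussian E).prod (stdGaussian E))) := by
    refine tendsto_integral_of_dominated_convergence
      (fun z : E × E => (K * Real.pi * (‖z.1‖ + ‖z.2‖)) ^ 4)
      (fun n => (((hcont _).const_mul _).pow 4).aestronglyMeasurable) hdom ?_ ?_
    · refine fun n => .of_forall fun z => ?_
      rw [norm_pow, Real.norm_eq_abs]
      gcongr
      exact hbound n z
    · filter_upwards [hdiff] with z hz
      exact (tendsto_mul_rotationIncrement hz).pow 4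
  have hle : 16 * ∫ x, F x ^ 4 ∂stdGaussian E ≤ ∫ z, (Real.pi * fderiv ℝ F z.1 z.2) ^ 4
      ∂(stdGaussian E).prod (stdGaussian E) := by
    refine ge_of_tendsto hlim ?_
    filter_upwards [Filter.eventually_ne_atTop 0] with n hn
    exact integral_odd_pow_four_le_integral_rotationIncrement hK hF hodd hn
  refine hle.trans ?_
  have hint : Integrable (fun z : E × E => (Real.pi * fderiv ℝ F z.1 z.2) ^ 4)
      ((stdGaussian E).prod (stdGaussian E)) := by
    refine integrable_pow_four_of_abs_le_prod_stdGaussian (C := K * Real.pi)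
      (hmeas.const_mul _).aestronglyMeasurable fun z => ?_
    rw [abs_mul, abs_of_pos Real.pi_pos, ← Real.norm_eq_abs]
    have h1 := (fderiv ℝ F z.1).le_of_opNorm_le (hderiv z.1) z.2
    calc Real.pi * ‖fderiv ℝ F z.1 z.2‖ ≤ Real.pi * (K * ‖z.2‖) := by gcongr
      _ ≤ Real.pi * (K * (‖z.1‖ + ‖z.2‖)) := by
          gcongr
          exact le_add_of_nonneg_left (norm_nonneg _)
      _ = _ := by ring
  rw [integral_prod _ hint]
  have hM : 0 ≤ ∫ z, z ^ 4 ∂gaussianReal 0 1 := integral_nonneg fun z => by positivity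
  calc ∫ x, ∫ y, (Real.pi * fderiv ℝ F x y) ^ 4 ∂stdGaussian E ∂stdGaussian E
      ≤ ∫ _, (Real.pi * K) ^ 4 * ∫ z, z ^ 4 ∂gaussianReal 0 1 ∂stdGaussian E := by
        refine integral_mono hint.integral_prod_left (integrable_const _) fun x => ?_
        simp only [mul_pow, integral_const_mul]
        rw [integral_dual_pow_four_stdGaussian, ← mul_assoc]
        gcongr
        exact hderiv x
    _ = _ := by simp

end Gaussian

theorem integral_indicator_sq_le {Ω : Type*} [MeasurableSpace Ω] {μ : Measure Ω}
    [IsFiniteMeasure μ] {g : Ω → ℝ} {C : ℝ} (hg : AEStronglyMeasurable g μ)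
    (hC : ∀ᵐ u ∂μ, |g u| ≤ C) {A : Set Ω} (hA : MeasurableSet A) :
    ∫ u, A.indicator (fun u => g u ^ 2) u ∂μ ≤
      Real.sqrt (∫ u, g u ^ 4 ∂μ) * Real.sqrt (μ A).toReal := by
  have hg2 : MemLp (fun u => g u ^ 2) (ENNReal.ofReal 2) μ := by
    refine MemLp.of_bound (hg.pow 2) (C ^ 2) ?_
    filter_upwards [hC] with u hu
    rw [norm_pow, Real.norm_eq_abs]
    gcongr
  have hA2 : MemLp (A.indicator fun _ => (1 : ℝ)) (ENNReal.ofReal 2) μ :=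
    (memLp_const 1).indicator hA
  have key := integral_mul_le_Lp_mul_Lq_of_nonneg Real.HolderConjugate.two_two
    (.of_forall fun u => sq_nonneg (g u))
    (.of_forall fun u => Set.indicator_nonneg (fun _ _ => zero_le_one) u) hg2 hA2
  have h1 : ∀ u, (g u ^ 2) ^ (2 : ℝ) = g u ^ 4 := fun u => by
    rw [Real.rpow_two]
    ring
  have h2 : ∀ u, (A.indicator (fun _ => (1 : ℝ)) u) ^ (2 : ℝ) = A.indicator (fun _ => 1) u :=
    fun u => by by_cases hu : u ∈ A <;> simp [hu]
  have h3 : ∀ u, g u ^ 2 * A.indicator (fun _ => (1 : ℝ)) u =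
      A.indicator (fun u => g u ^ 2) u := fun u => by by_cases hu : u ∈ A <;> simp [hu]
  simp_rw [h1, h2, h3, ← Real.sqrt_eq_rpow] at key
  rwa [integral_indicator_const _ hA, smul_eq_mul, mul_one] at key

theorem integral_norm_mul_direction_pow_four {d : ℕ} (hd : 1 ≤ d)
    {h : EuclideanSpace ℝ (Fin d) → ℝ} (hh : Measurable h) :
    ∫ x, (‖x‖ * h (‖x‖⁻¹ • x)) ^ 4 ∂stdGaussian (EuclideanSpace ℝ (Fin d)) =
      (∫ x, ‖x‖ ^ 4 ∂stdGaussian (EuclideanSpace ℝ (Fin d))) *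
        ∫ u, h u ^ 4 ∂sphereUniform d := by
  rw [integral_eq_lintegral_of_nonneg_ae (.of_forall fun x => by positivity)
      (by fun_prop : Measurable _).aestronglyMeasurable,
    integral_eq_lintegral_of_nonneg_ae (.of_forall fun x => by positivity)
      (by fun_prop : Measurable _).aestronglyMeasurable,
    integral_eq_lintegral_of_nonneg_ae (.of_forall fun x => by positivity)
      (by fun_prop : Measurable _).aestronglyMeasurable, ← ENNReal.toReal_mul]
  congr 1
  simp_rw [mul_pow, fun x : EuclideanSpace ℝ (Fin d) =>
    ENNReal.ofReal_mul (q := h (‖x‖⁻¹ • x) ^ 4) (by positivity : 0 ≤ ‖x‖ ^ 4)]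
  rw [stdGaussian_eq_withDensity]
  exact lintegral_withDensity_norm_mul_direction hd
    (ρ := fun r => ENNReal.ofReal
      (((2 * Real.pi) ^ (Module.finrank ℝ (EuclideanSpace ℝ (Fin d)) / 2 : ℝ))⁻¹ *
        Real.exp (-(1 / 2) * r ^ 2)))
    (φ := fun r => ENNReal.ofReal (r ^ 4)) (H := fun u => ENNReal.ofReal (h u ^ 4))
    (by fun_prop) (by fun_prop) (by fun_prop)

theorem ae_norm_le_one_sphereUniform (d : ℕ) : ∀ᵐ u ∂sphereUniform d, ‖u‖ ≤ 1 := by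
  rw [sphereUniform, ae_map_iff (by fun_prop) (measurableSet_le (by fun_prop) (by fun_prop))]
  refine .of_forall fun v => ?_
  rw [norm_smul, norm_inv, norm_norm]
  exact inv_mul_le_one

/-- The fourth moment of an odd `K`-Lipschitz function on the sphere is of order `K ^ 4 / d ^ 2`. -/
theorem sq_mul_integral_odd_pow_four_sphereUniform_le {d : ℕ} (hd : 1 ≤ d)
    {h : EuclideanSpace ℝ (Fin d) → ℝ} {K : ℝ} (hK : 0 ≤ K)
    (hh : ∀ x y, |h x - h y| ≤ K * ‖x - y‖) (hodd : ∀ x, h (-x) = -h x) :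
    16 * ((d : ℝ) ^ 2 * ∫ u, h u ^ 4 ∂sphereUniform d) ≤
      (Real.pi * (3 * K)) ^ 4 * ∫ z, z ^ 4 ∂gaussianReal 0 1 := by
  have h0 : h 0 = 0 := by
    have := hodd 0
    rw [neg_zero] at this
    linarith
  have hhc : Continuous h := (LipschitzWith.of_dist_le' fun x y => by
    rw [Real.dist_eq, dist_eq_norm]
    exact hh x y).continuous
  have h1 := integral_odd_pow_four_stdGaussian_le (F := fun x => ‖x‖ * h (‖x‖⁻¹ • x))
    (by positivity) (abs_norm_mul_direction_sub_le hK hh h0) (fun x => by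
      simp only [norm_neg, smul_neg, hodd, mul_neg])
  rw [integral_norm_mul_direction_pow_four hd hhc.measurable] at h1
  refine le_trans ?_ h1
  have h2 := sq_finrank_le_integral_norm_pow_four_stdGaussian (E := EuclideanSpace ℝ (Fin d))
  rw [finrank_euclideanSpace_fin] at h2
  have h3 : 0 ≤ ∫ u, h u ^ 4 ∂sphereUniform d := integral_nonneg fun u => by positivity
  gcongr

/-- Lemma 7: there is a universal constant `c > 0` such that for every `L`-Lipschitz `f`,
every `x`, and every symmetric measurable `A ⊆ 𝕊`,
`E_u[(d²/(4δ²))(f(x+δu) − f(x−δu))² 1_A(u)] ≤ c d L² √(σ(A))`. -/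
theorem stmt6 :
    ∃ c : ℝ, 0 < c ∧
      ∀ (d : ℕ), 1 ≤ d → ∀ δ L : ℝ, 0 < δ → 0 ≤ L →
        ∀ f : EuclideanSpace ℝ (Fin d) → ℝ, (∀ x y, |f x - f y| ≤ L * ‖x - y‖) →
        ∀ x : EuclideanSpace ℝ (Fin d),
        ∀ A : Set (EuclideanSpace ℝ (Fin d)),
          A ⊆ Metric.sphere 0 1 → MeasurableSet A → (∀ u, -u ∈ A ↔ u ∈ A) →
          ∫ u, A.indicator
              (fun u => (d : ℝ) ^ 2 / (4 * δ ^ 2) * (f (x + δ • u) - f (x - δ • u)) ^ 2) u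
            ∂(sphereUniform d) ≤
          c * d * L ^ 2 * Real.sqrt ((sphereUniform d A).toReal) := by
  set M := ∫ z, z ^ 4 ∂gaussianReal 0 1
  have hM : 0 ≤ M := integral_nonneg fun z => by positivity
  refine ⟨9 * Real.pi ^ 2 / 4 * Real.sqrt M + 1, by positivity, ?_⟩
  intro d hd δ L hδ hL f hf x A _ hA _
  have := isProbabilityMeasure_sphereUniform d
  set h : EuclideanSpace ℝ (Fin d) → ℝ := fun u => f (x + δ • u) - f (x - δ • u) with hdef
  set K := 2 * L * δ
  have hK : 0 ≤ K := by positivity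
  have hh : ∀ u v, |h u - h v| ≤ K * ‖u - v‖ := by
    intro u v
    have h1 := hf (x + δ • u) (x + δ • v)
    have h2 := hf (x - δ • v) (x - δ • u)
    rw [show x + δ • u - (x + δ • v) = δ • (u - v) by module, norm_smul, Real.norm_eq_abs,
      abs_of_pos hδ] at h1
    rw [show x - δ • v - (x - δ • u) = δ • (u - v) by module, norm_smul, Real.norm_eq_abs,
      abs_of_pos hδ] at h2
    calc |h u - h v| = |(f (x + δ • u) - f (x + δ • v)) + (f (x - δ • v) - f (x - δ • u))| := by
          simp only [hdef]
          congr 1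
          ring
      _ ≤ L * (δ * ‖u - v‖) + L * (δ * ‖u - v‖) := (abs_add_le _ _).trans (add_le_add h1 h2)
      _ = K * ‖u - v‖ := by ring
  have hodd : ∀ u, h (-u) = -h u := fun u => by
    simp only [hdef, smul_neg, sub_neg_eq_add, ← sub_eq_add_neg, neg_sub]
  have hhc : Continuous h := (LipschitzWith.of_dist_le' fun u v => by
    rw [Real.dist_eq, dist_eq_norm]
    exact hh u v).continuous
  have hbound : ∀ᵐ u ∂sphereUniform d, |h u| ≤ K := by
    filter_upwards [ae_norm_le_one_sphereUniform d] with u hu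
    have h0 : h 0 = 0 := by simp [hdef]
    have h1 := hh u 0
    rw [h0, sub_zero, sub_zero] at h1
    nlinarith
  have hmom := sq_mul_integral_odd_pow_four_sphereUniform_le hd hK hh hodd
  have hCS := integral_indicator_sq_le hhc.aestronglyMeasurable hbound hA
  have hd0 : (0 : ℝ) < d := by exact_mod_cast hd
  have hsqrt : Real.sqrt (∫ u, h u ^ 4 ∂sphereUniform d) ≤
      9 * Real.pi ^ 2 * L ^ 2 * δ ^ 2 / d * Real.sqrt M := by
    refine Real.sqrt_le_iff.2 ⟨by positivity, ?_⟩
    rw [mul_pow, Real.sq_sqrt hM, div_pow, div_mul_eq_mul_div, le_div_iff₀ (by positivity)]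
    calc (∫ u, h u ^ 4 ∂sphereUniform d) * d ^ 2
        = 16 * (d ^ 2 * ∫ u, h u ^ 4 ∂sphereUniform d) / 16 := by ring
      _ ≤ (Real.pi * (3 * K)) ^ 4 * M / 16 := by gcongr
      _ = _ := by
        simp only [K]
        ring
  have hconst : ∀ u, A.indicator (fun u => (d : ℝ) ^ 2 / (4 * δ ^ 2) *
      (f (x + δ • u) - f (x - δ • u)) ^ 2) u =
      (d : ℝ) ^ 2 / (4 * δ ^ 2) * A.indicator (fun u => h u ^ 2) u := fun u => by
    by_cases hu : u ∈ A <;> simp [hu, hdef]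
  simp_rw [hconst]
  rw [integral_const_mul]
  set s := Real.sqrt (sphereUniform d A).toReal
  have hs : 0 ≤ s := Real.sqrt_nonneg _
  calc (d : ℝ) ^ 2 / (4 * δ ^ 2) * ∫ u, A.indicator (fun u => h u ^ 2) u ∂sphereUniform d
      ≤ (d : ℝ) ^ 2 / (4 * δ ^ 2) *
          (9 * Real.pi ^ 2 * L ^ 2 * δ ^ 2 / d * Real.sqrt M * s) := by
        gcongr
        exact hCS.trans (by gcongr)
    _ = 9 * Real.pi ^ 2 / 4 * Real.sqrt M * d * L ^ 2 * s := by
        field_simp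
    _ ≤ (9 * Real.pi ^ 2 / 4 * Real.sqrt M + 1) * d * L ^ 2 * s := by
        gcongr
        exact le_add_of_nonneg_right zero_le_one
end
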